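/- Let σ ∈ S_n²(k) with 2k ≤ n − 2, and let σ̄_{k+1} ∈ S_n²(k+1) be defined as in the context. Then: (a) σ ≺ σ̄_{k+1}; (b) for every p ≥ k+1 and every σ' ∈ S_n²(p) with σ ≺ σ', one has σ̄_{k+1} ⪯ σ'; and (c) c(σ̄_{k+1}) + f(σ̄_{k+1}) = c(σ) + f(σ) + (n − 2k − 2) − |E_max(σ)|. -/

import Mathlib

namespace LinkPat

variable {n : ℕ}

/-- `σ` is an involution (σ² = id). -/
def IsInvol (σ : Equiv.Perm (Fin n)) : Prop := ∀ p, σ (σ p) = p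

/-- `(i,j)` is an arc of `σ`: `i < j` and `σ i = j`. -/
def IsArc (σ : Equiv.Perm (Fin n)) (i j : Fin n) : Prop := i < j ∧ σ i = j

/-- The finite set of arcs of `σ`. -/
def arcs (σ : Equiv.Perm (Fin n)) : Finset (Fin n × Fin n) :=
  Finset.univ.filter fun a => a.1 < a.2 ∧ σ a.1 = a.2

/-- The number of arcs of `σ`. -/
def numArcs (σ : Equiv.Perm (Fin n)) : ℕ := (arcs σ).card

/-- `c(σ)`: the number of crossings, i.e. pairs of arcs `(i,j)`, `(i',j')` with
`i < i' < j < j'`. -/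
def crossNum (σ : Equiv.Perm (Fin n)) : ℕ :=
  ((arcs σ ×ˢ arcs σ).filter fun x => x.1.1 < x.2.1 ∧ x.2.1 < x.1.2 ∧ x.1.2 < x.2.2).card

/-- `f(σ)`: the sum over fixed points `p` of the number of arcs over `p`. -/
def fixNum (σ : Equiv.Perm (Fin n)) : ℕ :=
  (((Finset.univ.filter fun p => σ p = p) ×ˢ arcs σ).filter
    fun x => x.2.1 < x.1 ∧ x.1 < x.2.2).card

/-- The rank matrix `R_σ`: entry `(i,j)` is the number of arcs inside `[i,j]`. -/
def Rmat (σ : Equiv.Perm (Fin n)) (i j : Fin n) : ℕ :=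
  ((arcs σ).filter fun a => i ≤ a.1 ∧ a.2 ≤ j).card

/-- The partial order `σ' ⪯ σ` given by pointwise comparison of rank matrices. -/
def rle (σ' σ : Equiv.Perm (Fin n)) : Prop := ∀ i j, Rmat σ' i j ≤ Rmat σ i j

/-- The strict order `σ' ≺ σ`. -/
def rlt (σ' σ : Equiv.Perm (Fin n)) : Prop := rle σ' σ ∧ σ' ≠ σ

end LinkPat

namespace LinkPat

/-- `E_max(σ)` as a finite set: the external arcs of `σ` such that every fixed
point of `σ` lies strictly inside them. -/
def EmaxSet {n : ℕ} (σ : Equiv.Perm (Fin n)) : Finset (Fin n × Fin n) :=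
  (arcs σ).filter fun a =>
    (∀ b ∈ arcs σ, ¬(b.1 < a.1 ∧ a.2 < b.2)) ∧ ∀ p : Fin n, σ p = p → a.1 < p ∧ p < a.2

end LinkPat

namespace LinkPat

section Pairs

variable {α : Type*} [LinearOrder α]

/-- The indicator of the pair `x` lying inside `[i, j]`. -/
def inside (i j : α) (x : α × α) : ℤ := if i ≤ x.1 ∧ x.2 ≤ j then 1 else 0

/-- The indicator of the pair `x` strictly enclosing `[i, j]`. -/
def outside (i j : α) (x : α × α) : ℤ := if x.1 < i ∧ j < x.2 then 1 else 0

/-- The indicator of the point `p` lying strictly under the pair `x`. -/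
def covers (p : α) (x : α × α) : ℤ := if x.1 < p ∧ p < x.2 then 1 else 0

/-- The indicator of the pairs `x`, `y` crossing, with `x` starting first. -/
def cross (x y : α × α) : ℤ := if x.1 < y.1 ∧ y.1 < x.2 ∧ x.2 < y.2 then 1 else 0

/-- No member of `s` is strictly nested in another one. -/
def Unnested (s : Finset (α × α)) : Prop :=
  ∀ x ∈ s, ∀ y ∈ s, ¬(x.1 < y.1 ∧ y.2 < x.2)

/-- The rank (counted from `1`) of `a` in the finite set `A`. -/
def rankIn (A : Finset α) (a : α) : ℕ := (A.filter fun x => x ≤ a).card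

/-- The pairs in `A ×ˢ B` whose components have the same rank. -/
def rankPairs (A B : Finset α) : Finset (α × α) :=
  (A ×ˢ B).filter fun x => rankIn A x.1 = rankIn B x.2

theorem inside_nonneg (i j : α) (x : α × α) : 0 ≤ inside i j x := by
  unfold inside; split_ifs <;> simp

theorem outside_nonneg (i j : α) (x : α × α) : 0 ≤ outside i j x := by
  unfold outside; split_ifs <;> simp

theorem sum_inside_nonneg (s : Finset (α × α)) (i j : α) : 0 ≤ ∑ x ∈ s, inside i j x :=
  Finset.sum_nonneg fun x _ => inside_nonneg i j x

theorem sum_outside_nonneg (s : Finset (α × α)) (i j : α) : 0 ≤ ∑ x ∈ s, outside i j x :=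
  Finset.sum_nonneg fun x _ => outside_nonneg i j x

theorem rankIn_lt {A : Finset α} {a b : α} (hb : b ∈ A) (hab : a < b) :
    rankIn A a < rankIn A b := by
  refine Finset.card_lt_card (Finset.ssubset_iff_of_subset ?_ |>.2 ⟨b, ?_, ?_⟩)
  · intro x hx
    simp only [Finset.mem_filter] at hx ⊢
    exact ⟨hx.1, hx.2.trans hab.le⟩
  · simp [hb]
  · simp [hab]

theorem rankIn_injOn (A : Finset α) : Set.InjOn (rankIn A) A := by
  intro a ha b hb h
  rcases lt_trichotomy a b with hab | hab | hab
  · exact absurd h (rankIn_lt hb hab).ne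
  · exact hab
  · exact absurd h (rankIn_lt ha hab).ne'

theorem image_rankIn (A : Finset α) : A.image (rankIn A) = Finset.Icc 1 A.card := by
  refine Finset.eq_of_subset_of_card_le ?_ ?_
  · intro r hr
    obtain ⟨a, ha, rfl⟩ := Finset.mem_image.1 hr
    refine Finset.mem_Icc.2 ⟨Finset.card_pos.2 ⟨a, by simp [ha]⟩, Finset.card_filter_le _ _⟩
  · rw [Finset.card_image_of_injOn (rankIn_injOn A)]
    simp

theorem exists_rankIn_eq {A B : Finset α} (h : A.card = B.card) {a : α} (ha : a ∈ A) :
    ∃ b ∈ B, rankIn B b = rankIn A a := by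
  have : rankIn A a ∈ B.image (rankIn B) := by
    rw [image_rankIn, ← h, ← image_rankIn]
    exact Finset.mem_image_of_mem _ ha
  simpa using this

theorem mem_rankPairs {A B : Finset α} {x : α × α} :
    x ∈ rankPairs A B ↔ x.1 ∈ A ∧ x.2 ∈ B ∧ rankIn A x.1 = rankIn B x.2 := by
  simp [rankPairs, and_assoc]

theorem unnested_rankPairs (A B : Finset α) : Unnested (rankPairs A B) := by
  intro x hx y hy h
  rw [mem_rankPairs] at hx hy
  have h1 := rankIn_lt hy.1 h.1
  have h2 := rankIn_lt hx.2.1 h.2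
  omega

theorem rankPairs_fst_injOn (A B : Finset α) : Set.InjOn Prod.fst
    (rankPairs A B : Set (α × α)) := by
  intro x hx y hy h
  have hx := mem_rankPairs.1 hx
  have hy := mem_rankPairs.1 hy
  exact Prod.ext h (rankIn_injOn B hx.2.1 hy.2.1 (by rw [← hx.2.2, ← hy.2.2, h]))

theorem rankPairs_snd_injOn (A B : Finset α) : Set.InjOn Prod.snd
    (rankPairs A B : Set (α × α)) := by
  intro x hx y hy h
  have hx := mem_rankPairs.1 hx
  have hy := mem_rankPairs.1 hy
  exact Prod.ext (rankIn_injOn A hx.1 hy.1 (by rw [hx.2.2, hy.2.2, h])) h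

theorem image_fst_rankPairs {A B : Finset α} (h : A.card = B.card) :
    (rankPairs A B).image Prod.fst = A := by
  ext a
  constructor
  · intro ha
    obtain ⟨x, hx, rfl⟩ := Finset.mem_image.1 ha
    exact (mem_rankPairs.1 hx).1
  · intro ha
    obtain ⟨b, hb, hab⟩ := exists_rankIn_eq h ha
    exact Finset.mem_image.2 ⟨(a, b), mem_rankPairs.2 ⟨ha, hb, hab.symm⟩, rfl⟩

theorem image_snd_rankPairs {A B : Finset α} (h : A.card = B.card) :
    (rankPairs A B).image Prod.snd = B := by
  ext b
  constructor
  · intro hb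
    obtain ⟨x, hx, rfl⟩ := Finset.mem_image.1 hb
    exact (mem_rankPairs.1 hx).2.1
  · intro hb
    obtain ⟨a, ha, hab⟩ := exists_rankIn_eq h.symm hb
    exact Finset.mem_image.2 ⟨(a, b), mem_rankPairs.2 ⟨ha, hb, hab⟩, rfl⟩

theorem Unnested.sum_inside_eq_zero_or {s : Finset (α × α)} (hs : Unnested s) (i j : α) :
    ∑ x ∈ s, inside i j x = 0 ∨ ∑ x ∈ s, outside i j x = 0 := by
  by_cases h : ∃ y ∈ s, y.1 < i ∧ j < y.2
  · obtain ⟨y, hy, h1, h2⟩ := h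
    left
    refine Finset.sum_eq_zero fun x hx => if_neg fun h => hs y hy x hx ⟨?_, ?_⟩
    · exact h1.trans_le h.1
    · exact h.2.trans_lt h2
  · right
    exact Finset.sum_eq_zero fun x hx => if_neg fun h' => h ⟨x, hx, h'⟩

/-- `N` matches monotonically the first components of `E` together with `a`, and the second
components of `E` together with `b`, where all members of `E` strictly enclose `a < b`. -/
structure IsShift (E N : Finset (α × α)) (a b : α) : Prop where
  lt : a < b
  unnested_left : Unnested E
  unnested_right : Unnested N
  left_bounds : ∀ x ∈ E, x.1 < a ∧ b < x.2
  right_bounds : ∀ x ∈ N, x.1 ≤ a ∧ b ≤ x.2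
  sum_fst : ∀ g : α → ℤ, ∑ x ∈ N, g x.1 = ∑ x ∈ E, g x.1 + g a
  sum_snd : ∀ g : α → ℤ, ∑ x ∈ N, g x.2 = ∑ x ∈ E, g x.2 + g b

theorem isShift_rankPairs {E : Finset (α × α)} {a b : α} (hab : a < b) (hE : Unnested E)
    (hb : ∀ x ∈ E, x.1 < a ∧ b < x.2) (h1 : Set.InjOn Prod.fst (E : Set (α × α)))
    (h2 : Set.InjOn Prod.snd (E : Set (α × α))) :
    IsShift E (rankPairs (insert a (E.image Prod.fst)) (insert b (E.image Prod.snd))) a b := by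
  have ha' : a ∉ E.image Prod.fst := by
    intro h
    obtain ⟨x, hx, rfl⟩ := Finset.mem_image.1 h
    exact lt_irrefl _ (hb x hx).1
  have hb' : b ∉ E.image Prod.snd := by
    intro h
    obtain ⟨x, hx, rfl⟩ := Finset.mem_image.1 h
    exact lt_irrefl _ (hb x hx).2
  have hcard : (insert a (E.image Prod.fst)).card = (insert b (E.image Prod.snd)).card := by
    rw [Finset.card_insert_of_notMem ha', Finset.card_insert_of_notMem hb',
      Finset.card_image_of_injOn h1, Finset.card_image_of_injOn h2]
  refine ⟨hab, hE, unnested_rankPairs _ _, hb, ?_, ?_, ?_⟩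
  · intro x hx
    obtain ⟨hx1, hx2, -⟩ := mem_rankPairs.1 hx
    constructor
    · rcases Finset.mem_insert.1 hx1 with h | h
      · exact h.le
      · obtain ⟨y, hy, hyx⟩ := Finset.mem_image.1 h
        exact hyx ▸ (hb y hy).1.le
    · rcases Finset.mem_insert.1 hx2 with h | h
      · exact h.ge
      · obtain ⟨y, hy, hyx⟩ := Finset.mem_image.1 h
        exact hyx ▸ (hb y hy).2.le
  · intro g
    rw [← Finset.sum_image (f := g) (rankPairs_fst_injOn _ _), image_fst_rankPairs hcard,
      Finset.sum_insert ha', Finset.sum_image h1, add_comm]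
  · intro g
    rw [← Finset.sum_image (f := g) (rankPairs_snd_injOn _ _), image_snd_rankPairs hcard,
      Finset.sum_insert hb', Finset.sum_image h2, add_comm]

theorem sum_inside_eq (s : Finset (α × α)) (i j : α) :
    ∑ x ∈ s, inside i j x = ∑ x ∈ s, (if i ≤ x.1 then (1 : ℤ) else 0)
      + ∑ x ∈ s, (if x.2 ≤ j then (1 : ℤ) else 0) - s.card + ∑ x ∈ s, outside i j x := by
  rw [Finset.cast_card, ← Finset.sum_add_distrib, ← Finset.sum_sub_distrib,
    ← Finset.sum_add_distrib]
  refine Finset.sum_congr rfl fun x _ => ?_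
  unfold inside outside
  grind

namespace IsShift

variable {E N : Finset (α × α)} {a b : α}

theorem card_right (h : IsShift E N a b) : (N.card : ℤ) = E.card + 1 := by
  simpa using h.sum_fst fun _ => 1

theorem sum_inside (h : IsShift E N a b) (i j : α) :
    ∑ x ∈ N, inside i j x = ∑ x ∈ E, inside i j x +
      if i ≤ a ∧ b ≤ j ∧ ∀ y ∈ E, ¬(y.1 < i ∧ j < y.2) then 1 else 0 := by
  by_cases hij : i ≤ a ∧ b ≤ j
  · have hN := sum_inside_eq N i j
    have hE := sum_inside_eq E i j
    rw [h.sum_fst fun p => if i ≤ p then 1 else 0, h.sum_snd fun p => if p ≤ j then 1 else 0,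
      h.card_right, if_pos hij.1, if_pos hij.2] at hN
    have hN0 := h.unnested_right.sum_inside_eq_zero_or i j
    have hE0 := h.unnested_left.sum_inside_eq_zero_or i j
    have := sum_inside_nonneg N i j
    have := sum_inside_nonneg E i j
    have := sum_outside_nonneg N i j
    have := sum_outside_nonneg E i j
    by_cases hg : ∀ y ∈ E, ¬(y.1 < i ∧ j < y.2)
    · have : ∑ x ∈ E, outside i j x = 0 := Finset.sum_eq_zero fun x hx => if_neg (hg x hx)
      rw [if_pos ⟨hij.1, hij.2, hg⟩]
      omega
    · rw [if_neg fun h => hg h.2.2]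
      push Not at hg
      obtain ⟨y, hy, hyij⟩ := hg
      have : 0 < ∑ x ∈ E, outside i j x :=
        Finset.sum_pos' (fun x _ => outside_nonneg i j x) ⟨y, hy, by simp [outside, hyij]⟩
      omega
  · rw [if_neg fun h => hij ⟨h.1, h.2.1⟩, Finset.sum_eq_zero, Finset.sum_eq_zero, add_zero]
    · intro x hx
      have := h.left_bounds x hx
      exact if_neg fun h' => hij ⟨h'.1.trans this.1.le, this.2.le.trans h'.2⟩
    · intro x hx
      have := h.right_bounds x hx
      exact if_neg fun h' => hij ⟨h'.1.trans this.1, this.2.trans h'.2⟩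

end IsShift

theorem cross_add_cross {x y : α × α} (hy : y.1 < y.2) (h1 : x.1 ≠ y.1)
    (h2 : x.2 ≠ y.2) :
    cross x y + cross y x = covers y.1 x + covers y.2 x - 2 * inside x.1 x.2 y := by
  unfold cross covers inside
  grind

theorem two_mul_sum_cross {s : Finset (α × α)} (hs : Unnested s) {a b : α} (hab : a < b)
    (hb : ∀ x ∈ s, x.1 ≤ a ∧ b ≤ x.2) (h1 : Set.InjOn Prod.fst (s : Set (α × α)))
    (h2 : Set.InjOn Prod.snd (s : Set (α × α))) :
    2 * ∑ x ∈ s, ∑ y ∈ s, cross x y = (s.card : ℤ) ^ 2 - s.card := by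
  have key : ∀ x ∈ s, ∀ y ∈ s, cross x y + cross y x = 1 - if x = y then 1 else 0 := by
    intro x hx y hy
    by_cases hxy : x = y
    · subst hxy
      simp [cross]
    · have h1' : x.1 ≠ y.1 := fun h => hxy (h1 hx hy h)
      have h2' : x.2 ≠ y.2 := fun h => hxy (h2 hx hy h)
      have hxy' := hs x hx y hy
      have hyx' := hs y hy x hx
      have hbx := hb x hx
      have hby := hb y hy
      unfold cross
      grind
  have hsum : ∑ x ∈ s, ∑ y ∈ s, (cross x y + cross y x) = (s.card : ℤ) ^ 2 - s.card := by
    rw [Finset.sum_congr rfl fun x hx => Finset.sum_congr rfl (key x hx)]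
    simp [Finset.sum_sub_distrib, sq]
  rw [← hsum]
  simp only [Finset.sum_add_distrib]
  rw [Finset.sum_comm (f := fun x y => cross y x), two_mul]

theorem sum_cross_union (R s : Finset (α × α)) :
    ∑ x ∈ R, (∑ y ∈ R, cross x y + ∑ y ∈ s, cross x y)
      + ∑ x ∈ s, (∑ y ∈ R, cross x y + ∑ y ∈ s, cross x y)
    = ∑ x ∈ R, ∑ y ∈ R, cross x y + ∑ x ∈ R, ∑ y ∈ s, (cross x y + cross y x)
      + ∑ x ∈ s, ∑ y ∈ s, cross x y := by
  simp only [Finset.sum_add_distrib]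
  rw [Finset.sum_comm (s := s) (t := R)]
  ring

end Pairs

variable {n : ℕ}

/-- The fixed points of `σ`. -/
def fixedPts (σ : Equiv.Perm (Fin n)) : Finset (Fin n) := Finset.univ.filter fun p => σ p = p

theorem mem_arcs {σ : Equiv.Perm (Fin n)} {x : Fin n × Fin n} :
    x ∈ arcs σ ↔ x.1 < x.2 ∧ σ x.1 = x.2 := by
  simp [arcs]

theorem mem_EmaxSet {σ : Equiv.Perm (Fin n)} {x : Fin n × Fin n} :
    x ∈ EmaxSet σ ↔ x ∈ arcs σ ∧ (∀ b ∈ arcs σ, ¬(b.1 < x.1 ∧ x.2 < b.2)) ∧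
      ∀ p : Fin n, σ p = p → x.1 < p ∧ p < x.2 := by
  simp [EmaxSet]

theorem EmaxSet_subset (σ : Equiv.Perm (Fin n)) : EmaxSet σ ⊆ arcs σ :=
  Finset.filter_subset _ _

theorem unnested_EmaxSet (σ : Equiv.Perm (Fin n)) : Unnested (EmaxSet σ) :=
  fun _ hx _ hy h => (mem_EmaxSet.1 hy).2.1 _ (EmaxSet_subset σ hx) h

theorem cast_Rmat (σ : Equiv.Perm (Fin n)) (i j : Fin n) :
    (Rmat σ i j : ℤ) = ∑ x ∈ arcs σ, inside i j x := by
  simp [Rmat, inside]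

theorem cast_crossNum (σ : Equiv.Perm (Fin n)) :
    (crossNum σ : ℤ) = ∑ x ∈ arcs σ, ∑ y ∈ arcs σ, cross x y := by
  simp only [crossNum, cross, Finset.card_filter, Finset.sum_product]
  push_cast
  rfl

theorem cast_fixNum (σ : Equiv.Perm (Fin n)) :
    (fixNum σ : ℤ) = ∑ p ∈ fixedPts σ, ∑ x ∈ arcs σ, covers p x := by
  simp only [fixNum, covers, Finset.card_filter, Finset.sum_product, fixedPts]
  push_cast
  rfl

theorem fst_injOn_arcs (σ : Equiv.Perm (Fin n)) :
    Set.InjOn Prod.fst (arcs σ : Set (Fin n × Fin n)) := by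
  intro x hx y hy h
  have hx := mem_arcs.1 hx
  have hy := mem_arcs.1 hy
  exact Prod.ext h (by rw [← hx.2, ← hy.2, h])

theorem snd_injOn_arcs (σ : Equiv.Perm (Fin n)) :
    Set.InjOn Prod.snd (arcs σ : Set (Fin n × Fin n)) := by
  intro x hx y hy h
  have hx := mem_arcs.1 hx
  have hy := mem_arcs.1 hy
  exact Prod.ext (σ.injective (by rw [hx.2, hy.2, h])) h

theorem sum_cross_arcs {σ : Equiv.Perm (Fin n)} {s : Finset (Fin n × Fin n)}
    (hs : s ⊆ arcs σ) {x : Fin n × Fin n} (hx : x ∈ arcs σ)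
    (hxs : x ∉ s) :
    ∑ y ∈ s, (cross x y + cross y x) = ∑ y ∈ s, covers y.1 x + ∑ y ∈ s, covers y.2 x
      - 2 * ∑ y ∈ s, inside x.1 x.2 y := by
  rw [Finset.mul_sum, ← Finset.sum_add_distrib, ← Finset.sum_sub_distrib]
  refine Finset.sum_congr rfl fun y hy => ?_
  have hy' := hs hy
  have hne : x ≠ y := fun h => hxs (h ▸ hy)
  exact cross_add_cross (mem_arcs.1 hy').1
    (fun h => hne (fst_injOn_arcs σ hx hy' h))
    (fun h => hne (snd_injOn_arcs σ hx hy' h))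

namespace IsInvol

variable {σ : Equiv.Perm (Fin n)}

theorem fst_ne_snd (hσ : IsInvol σ) {x y : Fin n × Fin n} (hx : x ∈ arcs σ) (hy : y ∈ arcs σ) :
    x.1 ≠ y.2 := by
  intro h
  have hx := mem_arcs.1 hx
  have hy := mem_arcs.1 hy
  have h1 : x.2 = y.1 := by rw [← hx.2, h, ← hy.2, hσ]
  exact lt_asymm hx.1 (by rw [h, h1]; exact hy.1)

theorem fixed_iff (hσ : IsInvol σ) (p : Fin n) :
    σ p = p ↔ ∀ x ∈ arcs σ, x.1 ≠ p ∧ x.2 ≠ p := by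
  constructor
  · intro h x hx
    have hx := mem_arcs.1 hx
    constructor
    · rintro rfl
      exact hx.1.ne (h.symm.trans hx.2)
    · intro h'
      have : σ x.1 = σ p := by rw [hx.2, h', h]
      exact hx.1.ne ((σ.injective this).trans h'.symm)
  · intro h
    by_contra hp
    rcases lt_or_gt_of_ne hp with hlt | hlt
    · exact (h (σ p, p) (mem_arcs.2 ⟨hlt, hσ p⟩)).2 rfl
    · exact (h (p, σ p) (mem_arcs.2 ⟨hlt, rfl⟩)).1 rfl

theorem sum_eq (hσ : IsInvol σ) (g : Fin n → ℤ) :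
    ∑ p, g p = ∑ x ∈ arcs σ, (g x.1 + g x.2) + ∑ p ∈ fixedPts σ, g p := by
  have hd : Disjoint ((arcs σ).image Prod.fst) ((arcs σ).image Prod.snd) := by
    rw [Finset.disjoint_left]
    intro p hp hp'
    obtain ⟨x, hx, rfl⟩ := Finset.mem_image.1 hp
    obtain ⟨y, hy, hxy⟩ := Finset.mem_image.1 hp'
    exact hσ.fst_ne_snd hx hy hxy.symm
  have hc : (arcs σ).image Prod.fst ∪ (arcs σ).image Prod.snd = Finset.univ \ fixedPts σ := by
    ext p
    simp only [Finset.mem_union, Finset.mem_image, Finset.mem_sdiff, Finset.mem_univ, true_and,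
      fixedPts, Finset.mem_filter, hσ.fixed_iff p]
    grind
  rw [Finset.sum_add_distrib, ← Finset.sum_image (f := g) (fst_injOn_arcs σ),
    ← Finset.sum_image (f := g) (snd_injOn_arcs σ), ← Finset.sum_union hd, hc,
    Finset.sum_sdiff (Finset.subset_univ _)]

theorem card_fixedPts (hσ : IsInvol σ) : ((fixedPts σ).card : ℤ) = n - 2 * numArcs σ := by
  have := hσ.sum_eq fun _ => 1
  simp only [Finset.sum_const, Finset.card_univ, Fintype.card_fin] at this
  simp only [numArcs]
  simp at this
  linarith

/-- Counting the points outside of `[i, j]` by the arcs they belong to. -/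
theorem sum_inside_arcs (hσ : IsInvol σ) {i j : Fin n} (hij : i ≤ j) :
    ∑ x ∈ arcs σ, inside i j x = numArcs σ
      + ∑ x ∈ arcs σ, (if x.2 < i then (1 : ℤ) else 0)
      + ∑ x ∈ arcs σ, (if j < x.1 then (1 : ℤ) else 0)
      + ∑ x ∈ arcs σ, outside i j x
      + ∑ p ∈ fixedPts σ, (if p < i ∨ j < p then (1 : ℤ) else 0)
      - ∑ p, (if p < i ∨ j < p then (1 : ℤ) else 0) := by
  rw [hσ.sum_eq, numArcs, Finset.cast_card]
  suffices ∑ x ∈ arcs σ, inside i j x = ∑ x ∈ arcs σ, (1 + (if x.2 < i then (1 : ℤ) else 0)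
      + (if j < x.1 then (1 : ℤ) else 0) + outside i j x
      - ((if x.1 < i ∨ j < x.1 then (1 : ℤ) else 0) + if x.2 < i ∨ j < x.2 then 1 else 0)) by
    rw [this]
    simp only [Finset.sum_add_distrib, Finset.sum_sub_distrib]
    ring
  refine Finset.sum_congr rfl fun x hx => ?_
  have := (mem_arcs.1 hx).1
  unfold inside outside
  grind

end IsInvol

theorem rle.sum_left {σ τ : Equiv.Perm (Fin n)} (h : rle σ τ) (i : Fin n) :
    ∑ x ∈ arcs σ, (if x.2 < i then (1 : ℤ) else 0)
      ≤ ∑ x ∈ arcs τ, (if x.2 < i then (1 : ℤ) else 0) := by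
  obtain ⟨m, rfl⟩ : ∃ m, n = m + 1 := ⟨n - 1, by have := i.pos; omega⟩
  by_cases hi : i = 0
  · subst hi
    simp
  · have key : ∀ x : Fin (m + 1) × Fin (m + 1),
        (if x.2 < i then (1 : ℤ) else 0) = inside 0 (i - 1) x := by
      intro x
      have : x.2 < i ↔ x.2 ≤ i - 1 := by
        rw [Fin.le_def, Fin.lt_def, Fin.val_sub_one_of_ne_zero hi]
        have : (i : ℕ) ≠ 0 := fun h => hi (Fin.ext h)
        omega
      simp [inside, this]
    simp only [key, ← cast_Rmat]
    exact_mod_cast h 0 (i - 1)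

theorem rle.sum_right {σ τ : Equiv.Perm (Fin n)} (h : rle σ τ) (j : Fin n) :
    ∑ x ∈ arcs σ, (if j < x.1 then (1 : ℤ) else 0)
      ≤ ∑ x ∈ arcs τ, (if j < x.1 then (1 : ℤ) else 0) := by
  obtain ⟨m, rfl⟩ : ∃ m, n = m + 1 := ⟨n - 1, by have := j.pos; omega⟩
  by_cases hj : j = Fin.last m
  · subst hj
    simp [(Fin.le_last _).not_gt]
  · have key : ∀ x : Fin (m + 1) × Fin (m + 1),
        (if j < x.1 then (1 : ℤ) else 0) = inside (j + 1) (Fin.last m) x := by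
      intro x
      have : j < x.1 ↔ j + 1 ≤ x.1 := by
        rw [Fin.le_def, Fin.lt_def, Fin.val_add_one, if_neg hj]
        omega
      simp [inside, this, Fin.le_last]
    simp only [key, ← cast_Rmat]
    exact_mod_cast h (j + 1) (Fin.last m)

theorem exists_EmaxSet_enclosing {σ : Equiv.Perm (Fin n)} {x : Fin n × Fin n} (hx : x ∈ arcs σ)
    (hfix : ∀ p, σ p = p → x.1 < p ∧ p < x.2) :
    ∃ y ∈ EmaxSet σ, y.1 ≤ x.1 ∧ x.2 ≤ y.2 := by
  obtain ⟨y, hy, hmin⟩ := Finset.exists_min_image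
    ((arcs σ).filter fun y => y.1 ≤ x.1 ∧ x.2 ≤ y.2) Prod.fst ⟨x, by simp [hx]⟩
  simp only [Finset.mem_filter] at hy hmin
  obtain ⟨hy, hyx⟩ := hy
  refine ⟨y, mem_EmaxSet.2 ⟨hy, ?_, ?_⟩, hyx⟩
  · rintro b hb ⟨h1, h2⟩
    exact (hmin b ⟨hb, h1.le.trans hyx.1, hyx.2.trans h2.le⟩).not_gt h1
  · intro p hp
    exact ⟨hyx.1.trans_lt (hfix p hp).1, (hfix p hp).2.trans_le hyx.2⟩

/-- If no point outside of `[i, j]` is fixed by `σ` and no arc of `σ` strictly encloses `[i, j]`,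
then any larger involution with more arcs has more arcs inside `[i, j]`. -/
theorem Rmat_lt_of_rle {σ τ : Equiv.Perm (Fin n)} (hσ : IsInvol σ) (hτ : IsInvol τ)
    (h : rle σ τ) (hlt : numArcs σ < numArcs τ) {i j : Fin n} (hij : i ≤ j)
    (hfix : ∀ p, σ p = p → i ≤ p ∧ p ≤ j) (hout : ∀ x ∈ arcs σ, ¬(x.1 < i ∧ j < x.2)) :
    Rmat σ i j < Rmat τ i j := by
  zify
  rw [cast_Rmat, cast_Rmat, hσ.sum_inside_arcs hij, hτ.sum_inside_arcs hij]
  have h1 := h.sum_left i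
  have h2 := h.sum_right j
  have h3 : ∑ x ∈ arcs σ, outside i j x = 0 :=
    Finset.sum_eq_zero fun x hx => if_neg (hout x hx)
  have h4 := sum_outside_nonneg (arcs τ) i j
  have h5 : ∑ p ∈ fixedPts σ, (if p < i ∨ j < p then (1 : ℤ) else 0) = 0 := by
    refine Finset.sum_eq_zero fun p hp => if_neg ?_
    have := hfix p (by simpa [fixedPts] using hp)
    simp [this]
  have h6 : 0 ≤ ∑ p ∈ fixedPts τ, (if p < i ∨ j < p then (1 : ℤ) else 0) :=
    Finset.sum_nonneg fun p _ => by split_ifs <;> simp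
  have h7 : (numArcs σ : ℤ) < numArcs τ := by exact_mod_cast hlt
  linarith

/-- `τ` arises from `σ` by replacing `E_max(σ)` by `N`, a shift of `E_max(σ)` along the smallest
fixed point `a` and the largest fixed point `b` of `σ`. -/
structure IsBar (σ τ : Equiv.Perm (Fin n)) (N : Finset (Fin n × Fin n)) (a b : Fin n) :
    Prop where
  invol_left : IsInvol σ
  invol_right : IsInvol τ
  fixed_fst : σ a = a
  fixed_snd : σ b = b
  fixed_bounds : ∀ p, σ p = p → a ≤ p ∧ p ≤ b
  shift : IsShift (EmaxSet σ) N a b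
  disj : Disjoint (arcs σ \ EmaxSet σ) N
  arcs_eq : arcs τ = (arcs σ \ EmaxSet σ) ∪ N

namespace IsBar

variable {σ τ : Equiv.Perm (Fin n)} {N : Finset (Fin n × Fin n)} {a b : Fin n}

theorem sum_arcs_left (σ : Equiv.Perm (Fin n)) (g : Fin n × Fin n → ℤ) :
    ∑ x ∈ arcs σ, g x = ∑ x ∈ arcs σ \ EmaxSet σ, g x + ∑ x ∈ EmaxSet σ, g x :=
  (Finset.sum_sdiff (EmaxSet_subset σ)).symm

theorem sum_arcs_right (h : IsBar σ τ N a b) (g : Fin n × Fin n → ℤ) :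
    ∑ x ∈ arcs τ, g x = ∑ x ∈ arcs σ \ EmaxSet σ, g x + ∑ x ∈ N, g x := by
  rw [h.arcs_eq, Finset.sum_union h.disj]

theorem subset_right (h : IsBar σ τ N a b) : N ⊆ arcs τ :=
  h.arcs_eq ▸ Finset.subset_union_right

theorem sdiff_subset_right (h : IsBar σ τ N a b) : arcs σ \ EmaxSet σ ⊆ arcs τ :=
  h.arcs_eq ▸ Finset.subset_union_left

theorem not_enclosed (h : IsBar σ τ N a b) {i j : Fin n} (hi : i ≤ a) (hj : b ≤ j)
    (hE : ∀ y ∈ EmaxSet σ, ¬(y.1 < i ∧ j < y.2)) : ∀ x ∈ arcs σ, ¬(x.1 < i ∧ j < x.2) := by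
  rintro x hx ⟨h1, h2⟩
  obtain ⟨y, hy, hyx⟩ := exists_EmaxSet_enclosing hx fun p hp =>
    ⟨(h1.trans_le hi).trans_le (h.fixed_bounds p hp).1,
      (h.fixed_bounds p hp).2.trans_lt (hj.trans_lt h2)⟩
  exact hE y hy ⟨hyx.1.trans_lt h1, h2.trans_le hyx.2⟩

theorem cast_Rmat_right (h : IsBar σ τ N a b) (i j : Fin n) :
    (Rmat τ i j : ℤ) = Rmat σ i j +
      if i ≤ a ∧ b ≤ j ∧ ∀ y ∈ EmaxSet σ, ¬(y.1 < i ∧ j < y.2) then 1 else 0 := by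
  rw [cast_Rmat, cast_Rmat, h.sum_arcs_right, sum_arcs_left, h.shift.sum_inside, add_assoc]
  congr!

theorem rle_right (h : IsBar σ τ N a b) : rle σ τ := by
  intro i j
  have := h.cast_Rmat_right i j
  split_ifs at this <;> omega

theorem numArcs_right (h : IsBar σ τ N a b) : (numArcs τ : ℤ) = numArcs σ + 1 := by
  have h1 := h.sum_arcs_right fun _ => 1
  have h2 := sum_arcs_left σ fun _ => 1
  have h3 := h.shift.card_right
  simp only [Finset.sum_const, nsmul_one] at h1 h2
  unfold numArcs
  linarith

theorem rlt_right (h : IsBar σ τ N a b) : rlt σ τ := by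
  refine ⟨h.rle_right, ?_⟩
  rintro rfl
  have := h.numArcs_right
  omega

theorem rle_of_rlt (h : IsBar σ τ N a b) {ρ : Equiv.Perm (Fin n)} (hρ : IsInvol ρ)
    (hσρ : rle σ ρ) (hlt : numArcs σ < numArcs ρ) : rle τ ρ := by
  intro i j
  have hR := h.cast_Rmat_right i j
  have hle := hσρ i j
  split_ifs at hR with hg
  · have := Rmat_lt_of_rle h.invol_left hρ hσρ hlt
      (hg.1.trans (h.shift.lt.le.trans hg.2.1))
      (fun p hp => ⟨hg.1.trans (h.fixed_bounds p hp).1, (h.fixed_bounds p hp).2.trans hg.2.1⟩)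
      (h.not_enclosed hg.1 hg.2.1 hg.2.2)
    omega
  · omega

theorem sum_inside_sdiff (h : IsBar σ τ N a b) {x : Fin n × Fin n}
    (hx : x ∈ arcs σ \ EmaxSet σ) :
    ∑ y ∈ N, inside x.1 x.2 y = ∑ y ∈ EmaxSet σ, inside x.1 x.2 y := by
  rw [h.shift.sum_inside, if_neg, add_zero]
  rintro ⟨h1, h2, h3⟩
  obtain ⟨hx, hxE⟩ := Finset.mem_sdiff.1 hx
  have ha := (h.invol_left.fixed_iff a).1 h.fixed_fst x hx
  have hb := (h.invol_left.fixed_iff b).1 h.fixed_snd x hx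
  obtain ⟨y, hy, hyx⟩ := exists_EmaxSet_enclosing hx fun p hp =>
    ⟨(lt_of_le_of_ne h1 ha.1).trans_le (h.fixed_bounds p hp).1,
      (h.fixed_bounds p hp).2.trans_lt (lt_of_le_of_ne h2 hb.2.symm)⟩
  have hy' := EmaxSet_subset σ hy
  rcases eq_or_lt_of_le hyx.1 with he | hl
  · exact hxE (fst_injOn_arcs σ hy' hx he ▸ hy)
  · rcases eq_or_lt_of_le hyx.2 with he | hl'
    · exact hxE (snd_injOn_arcs σ hx hy' he ▸ hy)
    · exact h3 y hy ⟨hl, hl'⟩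

/-- The pairs of `N` cross a common arc as often as those of `E_max(σ)` do, once the positions of
the two new endpoints are taken into account. -/
theorem sum_cross_sdiff (h : IsBar σ τ N a b) {x : Fin n × Fin n}
    (hx : x ∈ arcs σ \ EmaxSet σ) :
    ∑ y ∈ N, (cross x y + cross y x) =
      ∑ y ∈ EmaxSet σ, (cross x y + cross y x) + covers a x + covers b x := by
  rw [sum_cross_arcs h.subset_right (h.sdiff_subset_right hx)
      (Finset.disjoint_left.1 h.disj hx),
    sum_cross_arcs (EmaxSet_subset σ) (Finset.mem_sdiff.1 hx).1 (Finset.mem_sdiff.1 hx).2,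
    h.sum_inside_sdiff hx, h.shift.sum_fst fun p => covers p x,
    h.shift.sum_snd fun p => covers p x]
  ring

theorem exists_fst_eq (h : IsBar σ τ N a b) {p : Fin n}
    (hp : p = a ∨ ∃ x ∈ EmaxSet σ, x.1 = p) : ∃ x ∈ N, x.1 = p := by
  by_contra! hN
  have hs := h.shift.sum_fst fun q => if q = p then 1 else 0
  rw [Finset.sum_eq_zero fun x hx => if_neg (hN x hx)] at hs
  have h0 : ∀ x ∈ EmaxSet σ, (0 : ℤ) ≤ if x.1 = p then 1 else 0 := fun x _ => by
    split_ifs <;> simp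
  rcases hp with rfl | ⟨x, hx, hxp⟩
  · have := Finset.sum_nonneg h0
    rw [if_pos rfl] at hs
    omega
  · have := Finset.sum_pos' h0 ⟨x, hx, by simp [hxp]⟩
    split_ifs at hs <;> omega

theorem exists_snd_eq (h : IsBar σ τ N a b) {p : Fin n}
    (hp : p = b ∨ ∃ x ∈ EmaxSet σ, x.2 = p) : ∃ x ∈ N, x.2 = p := by
  by_contra! hN
  have hs := h.shift.sum_snd fun q => if q = p then 1 else 0
  rw [Finset.sum_eq_zero fun x hx => if_neg (hN x hx)] at hs
  have h0 : ∀ x ∈ EmaxSet σ, (0 : ℤ) ≤ if x.2 = p then 1 else 0 := fun x _ => by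
    split_ifs <;> simp
  rcases hp with rfl | ⟨x, hx, hxp⟩
  · have := Finset.sum_nonneg h0
    rw [if_pos rfl] at hs
    omega
  · have := Finset.sum_pos' h0 ⟨x, hx, by simp [hxp]⟩
    split_ifs at hs <;> omega

theorem fixed_of_fixed_right (h : IsBar σ τ N a b) {p : Fin n} (hp : τ p = p) :
    σ p = p ∧ p ≠ a ∧ p ≠ b := by
  rw [h.invol_right.fixed_iff] at hp
  refine ⟨(h.invol_left.fixed_iff p).2 fun x hx => ?_, ?_, ?_⟩
  · by_cases hxE : x ∈ EmaxSet σ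
    · constructor
      · intro he
        obtain ⟨y, hy, hyp⟩ := h.exists_fst_eq (.inr ⟨x, hxE, he⟩)
        exact (hp y (h.subset_right hy)).1 hyp
      · intro he
        obtain ⟨y, hy, hyp⟩ := h.exists_snd_eq (.inr ⟨x, hxE, he⟩)
        exact (hp y (h.subset_right hy)).2 hyp
    · exact hp x (h.sdiff_subset_right (Finset.mem_sdiff.2 ⟨hx, hxE⟩))
  · intro he
    obtain ⟨y, hy, hyp⟩ := h.exists_fst_eq (.inl he)
    exact (hp y (h.subset_right hy)).1 hyp
  · intro he
    obtain ⟨y, hy, hyp⟩ := h.exists_snd_eq (.inl he)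
    exact (hp y (h.subset_right hy)).2 hyp

theorem fixedPts_eq (h : IsBar σ τ N a b) : fixedPts τ = ((fixedPts σ).erase a).erase b := by
  have ha : a ∈ fixedPts σ := by simp [fixedPts, h.fixed_fst]
  have hb : b ∈ (fixedPts σ).erase a := by simp [fixedPts, h.fixed_snd, h.shift.lt.ne']
  refine Finset.eq_of_subset_of_card_le (fun p hp => ?_) ?_
  · have := h.fixed_of_fixed_right (p := p) (by simpa [fixedPts] using hp)
    simp [fixedPts, this]
  · rw [Finset.card_erase_of_mem hb, Finset.card_erase_of_mem ha]
    have h1 := h.invol_left.card_fixedPts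
    have h2 := h.invol_right.card_fixedPts
    have h3 := h.numArcs_right
    omega

theorem sum_fixedPts_left (h : IsBar σ τ N a b) (g : Fin n → ℤ) :
    ∑ p ∈ fixedPts σ, g p = ∑ p ∈ fixedPts τ, g p + g a + g b := by
  have ha : a ∈ fixedPts σ := by simp [fixedPts, h.fixed_fst]
  have hb : b ∈ (fixedPts σ).erase a := by simp [fixedPts, h.fixed_snd, h.shift.lt.ne']
  rw [h.fixedPts_eq, ← Finset.sum_erase_add _ _ ha, ← Finset.sum_erase_add _ _ hb]
  ring

theorem sum_covers_EmaxSet {p : Fin n} (hp : σ p = p) :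
    ∑ x ∈ EmaxSet σ, covers p x = (EmaxSet σ).card := by
  rw [Finset.cast_card]
  exact Finset.sum_congr rfl fun x hx => if_pos ((mem_EmaxSet.1 hx).2.2 p hp)

theorem sum_covers_right (h : IsBar σ τ N a b) {p : Fin n} (hp : τ p = p) :
    ∑ x ∈ N, covers p x = (EmaxSet σ).card + 1 := by
  rw [← h.shift.card_right, Finset.cast_card]
  refine Finset.sum_congr rfl fun x hx => if_pos ?_
  obtain ⟨hp, hpa, hpb⟩ := h.fixed_of_fixed_right hp
  have h1 := h.fixed_bounds p hp
  have h2 := h.shift.right_bounds x hx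
  exact ⟨h2.1.trans_lt (lt_of_le_of_ne h1.1 hpa.symm), (lt_of_le_of_ne h1.2 hpb).trans_le h2.2⟩

theorem fixNum_right (h : IsBar σ τ N a b) :
    (fixNum σ : ℤ) + (fixedPts τ).card =
      fixNum τ + ∑ x ∈ arcs σ \ EmaxSet σ, (covers a x + covers b x)
        + 2 * (EmaxSet σ).card := by
  have hτ : ∀ p ∈ fixedPts τ,
      ∑ x ∈ arcs τ, covers p x = ∑ x ∈ arcs σ, covers p x + 1 := by
    intro p hp
    have hp : τ p = p := by simpa [fixedPts] using hp
    rw [h.sum_arcs_right, sum_arcs_left, h.sum_covers_right hp,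
      sum_covers_EmaxSet (h.fixed_of_fixed_right hp).1]
    ring
  rw [cast_fixNum, cast_fixNum, h.sum_fixedPts_left, Finset.sum_congr rfl hτ,
    sum_arcs_left σ (covers a), sum_arcs_left σ (covers b), sum_covers_EmaxSet h.fixed_fst,
    sum_covers_EmaxSet h.fixed_snd, Finset.sum_add_distrib, Finset.sum_add_distrib]
  simp only [Finset.sum_const, nsmul_one]
  ring

theorem crossNum_right (h : IsBar σ τ N a b) :
    (crossNum τ : ℤ) = crossNum σ + ∑ x ∈ arcs σ \ EmaxSet σ, (covers a x + covers b x)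
      + (EmaxSet σ).card := by
  have hN := two_mul_sum_cross h.shift.unnested_right h.shift.lt h.shift.right_bounds
    ((fst_injOn_arcs τ).mono h.subset_right)
    ((snd_injOn_arcs τ).mono h.subset_right)
  have hE := two_mul_sum_cross h.shift.unnested_left h.shift.lt
    (fun x hx => ⟨(h.shift.left_bounds x hx).1.le, (h.shift.left_bounds x hx).2.le⟩)
    ((fst_injOn_arcs σ).mono (EmaxSet_subset σ))
    ((snd_injOn_arcs σ).mono (EmaxSet_subset σ))
  rw [h.shift.card_right] at hN
  rw [cast_crossNum, cast_crossNum]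
  simp only [sum_arcs_left σ, h.sum_arcs_right]
  rw [sum_cross_union, sum_cross_union, Finset.sum_congr rfl fun x hx => h.sum_cross_sdiff hx]
  simp only [Finset.sum_add_distrib] at *
  linarith

end IsBar

end LinkPat

/-- properties of `σ̄_{k+1}`.  With `i_σ`, `j_σ` the smallest and the
largest fixed points of `σ` and `E_max(σ) = {(i_1,j_1) < … < (i_s,j_s)}` (ordered
by left endpoints), `σ̄_{k+1}` is obtained from `σ` by deleting the arcs of
`E_max(σ)` and adding the arcs `(i_1,j_σ), (i_2,j_1), …, (i_s,j_{s−1}), (i_σ,j_s)`;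
equivalently (hypothesis `harcs`), its arcs are the arcs of `σ` not in `E_max(σ)`,
together with the pairs `(a,b)` where `a` ranges over `{i_1,…,i_s,i_σ}`, `b` over
`{j_σ,j_1,…,j_s}`, and `a`, `b` have the same rank in these two sets.  Then
(a) `σ ≺ σ̄_{k+1}`; (b) `σ̄_{k+1} ⪯ σ'` for every involution `σ'` with at least
`k+1` arcs and `σ ≺ σ'`; (c) `c(σ̄_{k+1}) + f(σ̄_{k+1}) = c(σ) + f(σ) + (n−2k−2) −
|E_max(σ)|`. -/
theorem sigma_bar_properties (n k : ℕ) (σ : Equiv.Perm (Fin n))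
    (hσ : LinkPat.IsInvol σ) (hk : LinkPat.numArcs σ = k) (hn : 2 * k + 2 ≤ n)
    (iσ jσ : Fin n)
    (hiσ : σ iσ = iσ ∧ ∀ p : Fin n, σ p = p → iσ ≤ p)
    (hjσ : σ jσ = jσ ∧ ∀ p : Fin n, σ p = p → p ≤ jσ)
    (σbar : Equiv.Perm (Fin n)) (hσbar : LinkPat.IsInvol σbar)
    (harcs : ∀ a b : Fin n, LinkPat.IsArc σbar a b ↔
      ((LinkPat.IsArc σ a b ∧ (a, b) ∉ LinkPat.EmaxSet σ) ∨
       (a ∈ insert iσ ((LinkPat.EmaxSet σ).image Prod.fst) ∧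
        b ∈ insert jσ ((LinkPat.EmaxSet σ).image Prod.snd) ∧
        ((insert iσ ((LinkPat.EmaxSet σ).image Prod.fst)).filter fun x => x ≤ a).card =
        ((insert jσ ((LinkPat.EmaxSet σ).image Prod.snd)).filter fun y => y ≤ b).card))) :
    LinkPat.rlt σ σbar ∧
    (∀ σ' : Equiv.Perm (Fin n), LinkPat.IsInvol σ' → k + 1 ≤ LinkPat.numArcs σ' →
      LinkPat.rlt σ σ' → LinkPat.rle σbar σ') ∧
    (LinkPat.crossNum σbar : ℤ) + (LinkPat.fixNum σbar : ℤ)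
      = (LinkPat.crossNum σ : ℤ) + (LinkPat.fixNum σ : ℤ)
        + ((n : ℤ) - 2 * (k : ℤ) - 2) - ((LinkPat.EmaxSet σ).card : ℤ) := by
  have hcard := hσ.card_fixedPts
  have hlt : iσ < jσ := by
    obtain ⟨p, hp, q, hq, hpq⟩ := Finset.one_lt_card.1
      (show 1 < (LinkPat.fixedPts σ).card by omega)
    simp only [LinkPat.fixedPts, Finset.mem_filter, Finset.mem_univ, true_and] at hp hq
    rcases lt_or_gt_of_ne hpq with h | h
    · exact (hiσ.2 p hp).trans_lt (h.trans_le (hjσ.2 q hq))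
    · exact (hiσ.2 q hq).trans_lt (h.trans_le (hjσ.2 p hp))
  have hmem : ∀ x, x ∈ LinkPat.arcs σbar ↔ x ∈ (LinkPat.arcs σ \ LinkPat.EmaxSet σ) ∪
      LinkPat.rankPairs (insert iσ ((LinkPat.EmaxSet σ).image Prod.fst))
        (insert jσ ((LinkPat.EmaxSet σ).image Prod.snd)) := by
    rintro ⟨x, y⟩
    rw [Finset.mem_union, Finset.mem_sdiff, LinkPat.mem_rankPairs, LinkPat.mem_arcs,
      LinkPat.mem_arcs]
    exact harcs x y
  have h : LinkPat.IsBar σ σbar (LinkPat.rankPairs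
      (insert iσ ((LinkPat.EmaxSet σ).image Prod.fst))
      (insert jσ ((LinkPat.EmaxSet σ).image Prod.snd))) iσ jσ := by
    refine ⟨hσ, hσbar, hiσ.1, hjσ.1, fun p hp => ⟨hiσ.2 p hp, hjσ.2 p hp⟩, ?_, ?_,
      Finset.ext hmem⟩
    · exact LinkPat.isShift_rankPairs hlt (LinkPat.unnested_EmaxSet σ)
        (fun x hx => ⟨((LinkPat.mem_EmaxSet.1 hx).2.2 iσ hiσ.1).1,
          ((LinkPat.mem_EmaxSet.1 hx).2.2 jσ hjσ.1).2⟩)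
        ((LinkPat.fst_injOn_arcs σ).mono (LinkPat.EmaxSet_subset σ))
        ((LinkPat.snd_injOn_arcs σ).mono (LinkPat.EmaxSet_subset σ))
    · rw [Finset.disjoint_left]
      intro x hx hxN
      obtain ⟨hx, hxE⟩ := Finset.mem_sdiff.1 hx
      rcases Finset.mem_insert.1 (LinkPat.mem_rankPairs.1 hxN).1 with he | he
      · exact ((hσ.fixed_iff iσ).1 hiσ.1 x hx).1 he
      · obtain ⟨y, hy, hyx⟩ := Finset.mem_image.1 he
        exact hxE (LinkPat.fst_injOn_arcs σ (LinkPat.EmaxSet_subset σ hy) hx hyx ▸ hy)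
  refine ⟨h.rlt_right, fun σ' hσ' hk' hlt' => h.rle_of_rlt hσ' hlt'.1 (by omega), ?_⟩
  have h1 := h.crossNum_right
  have h2 := h.fixNum_right
  have h3 := hσbar.card_fixedPts
  have h4 := h.numArcs_right
  subst hk
  linarith
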